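/- (Relative entropy lower bound, part (IV).) Let ê : ℝ¹⁹×[0,∞) → ℝ (with ξ = (F,ζ,w) ∈ M₃(ℝ)×M₃(ℝ)×ℝ) be C³, uniformly convex (∇²_{(ξ,η)}ê ≥ c𝕀 for some c > 0), and satisfy the growth conditions (G1)–(G3) with exponents p ≥ 4, q ≥ 2, ρ > 1, ℓ > 1. Then for every M > 0 there exist constants K₁′, K₂′ > 0 and R > 0 sufficiently large such that for all (F,v,η) ∈ M₃(ℝ)×ℝ³×[0,∞) and all (F̄,v̄,η̄) ∈ Γ_M: if |F|^p + η^ℓ + |v|² > R then I(v,Φ(F),η | v̄,Φ(F̄),η̄) ≥ (K₁′/4)( |F − F̄|^p + |η − η̄|^ℓ + |v − v̄|² ), and if |F|^p + η^ℓ + |v|² ≤ R then I(v,Φ(F),η | v̄,Φ(F̄),η̄) ≥ K₂′( |Φ(F) − Φ(F̄)|² + |η − η̄|² + |v − v̄|² ). -/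

import Mathlib

open scoped BigOperators
noncomputable section

/-- 3×3 real matrices, modelled as `Fin 3 → Fin 3 → ℝ`. -/
abbrev Mat : Type := Fin 3 → Fin 3 → ℝ

/-- The Levi-Civita symbol on `{0,1,2}`. -/
def lc (i j k : Fin 3) : ℝ :=
  (((j : ℕ) : ℝ) - ((i : ℕ) : ℝ)) * (((k : ℕ) : ℝ) - ((i : ℕ) : ℝ)) *
    (((k : ℕ) : ℝ) - ((j : ℕ) : ℝ)) / 2

/-- The cofactor matrix `(cof F)_{iα} = (1/2) Σ ε_{ijk} ε_{αβγ} F_{jβ} F_{kγ}`. -/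
def cof (F : Mat) : Mat := fun i α =>
  (1 / 2) * ∑ j, ∑ k, ∑ β, ∑ γ, lc i j k * lc α β γ * F j β * F k γ

/-- The determinant `det F = (1/6) Σ ε_{ijk} ε_{αβγ} F_{iα} F_{jβ} F_{kγ}`. -/
def mdet (F : Mat) : ℝ :=
  (1 / 6) * ∑ i, ∑ j, ∑ k, ∑ α, ∑ β, ∑ γ, lc i j k * lc α β γ * F i α * F j β * F k γ

/-- Frobenius norm of a 3×3 matrix. -/
def frob (F : Mat) : ℝ := Real.sqrt (∑ i, ∑ j, F i j ^ 2)

/-- The extended state space `ξ = (F, ζ, w) ∈ M₃(ℝ) × M₃(ℝ) × ℝ ≅ ℝ¹⁹`. -/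
abbrev Xi : Type := Mat × Mat × ℝ

/-- Extended state together with the entropy: `(ξ, η) ∈ ℝ¹⁹ × ℝ`. -/
abbrev XE : Type := Xi × ℝ

/-- The natural domain `{η ≥ 0}` of the internal energy. -/
def Dom : Set XE := {x | 0 ≤ x.2}

/-- The null-Lagrangian vector `Φ(F) = (F, cof F, det F)`. -/
def Phi (F : Mat) : Xi := (F, cof F, mdet F)

/-- Directional derivative of `eh` at `x` in the pure-`ξ` direction `d`
(equivalently `Σ_B (∂eh/∂ξ^B)(x) d^B`), taken within the domain `{η ≥ 0}`. -/
def dXi (eh : XE → ℝ) (x : XE) (d : Xi) : ℝ :=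
  fderivWithin ℝ eh Dom x (d, 0)

/-- `θ̂ = ∂eh/∂η`, taken within the domain `{η ≥ 0}`. -/
def dEta (eh : XE → ℝ) (x : XE) : ℝ :=
  fderivWithin ℝ eh Dom x (0, 1)

/-- Matrix of partial derivatives `∂eh/∂F`. -/
def dFmat (eh : XE → ℝ) (x : XE) : Mat :=
  fun i j => dXi eh x (Pi.single i (Pi.single j 1), 0, 0)

/-- Matrix of partial derivatives `∂eh/∂ζ`. -/
def dZmat (eh : XE → ℝ) (x : XE) : Mat :=
  fun i j => dXi eh x (0, Pi.single i (Pi.single j 1), 0)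

/-- Partial derivative `∂eh/∂w`. -/
def dW (eh : XE → ℝ) (x : XE) : ℝ := dXi eh x (0, 0, 1)

/-- Second directional derivative of `eh` at `x`, in directions `u` (outer) and
`d` (inner), within the domain `{η ≥ 0}`. -/
def d2 (eh : XE → ℝ) (x : XE) (u d : XE) : ℝ :=
  fderivWithin ℝ (fun y => fderivWithin ℝ eh Dom y d) Dom x u

/-- The weight `|F|^p + |ζ|^q + |w|^ρ + |η|^ℓ` appearing in the growth conditions. -/
def bigN (p q ρ ℓ : ℝ) (x : XE) : ℝ :=
  frob x.1.1 ^ p + frob x.1.2.1 ^ q + |x.1.2.2| ^ ρ + |x.2| ^ ℓ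

/-- Uniform convexity `∇²_{(ξ,η)} eh ≥ c 𝕀` (as quadratic forms, with the Euclidean
norm on `ℝ¹⁹ × ℝ`). -/
def UnifConvex (eh : XE → ℝ) (c : ℝ) : Prop :=
  ∀ x ∈ Dom, ∀ d : XE,
    c * (frob d.1.1 ^ 2 + frob d.1.2.1 ^ 2 + d.1.2.2 ^ 2 + d.2 ^ 2) ≤ d2 eh x d d

/-- Growth condition (G1): `c N(ξ,η) - c ≤ eh(ξ,η) ≤ c N(ξ,η) + c`. -/
def GrowthG1 (eh : XE → ℝ) (c p q ρ ℓ : ℝ) : Prop :=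
  ∀ x ∈ Dom, c * bigN p q ρ ℓ x - c ≤ eh x ∧ eh x ≤ c * bigN p q ρ ℓ x + c

/-- Growth condition (G2): `∂_η eh / N → 0` as `N → ∞`. -/
def GrowthG2 (eh : XE → ℝ) (p q ρ ℓ : ℝ) : Prop :=
  ∀ ε > (0:ℝ), ∃ R : ℝ, ∀ x ∈ Dom, R ≤ bigN p q ρ ℓ x → |dEta eh x| ≤ ε * bigN p q ρ ℓ x

/-- Growth condition (G3):
`|∂_F eh|^{p/(p-1)} + |∂_ζ eh|^{p/(p-2)} + |∂_w eh|^{p/(p-3)} ≤ c N + c`. -/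
def GrowthG3 (eh : XE → ℝ) (c p q ρ ℓ : ℝ) : Prop :=
  ∀ x ∈ Dom,
    frob (dFmat eh x) ^ (p / (p-1)) + frob (dZmat eh x) ^ (p / (p-2))
      + |dW eh x| ^ (p / (p-3)) ≤ c * bigN p q ρ ℓ x + c

/-- The relative internal energy
`eh(ξ,η | ξ̄,η̄) = eh(ξ,η) − eh(ξ̄,η̄) − ∇_ξ eh(ξ̄,η̄)·(ξ−ξ̄) − ∂_η eh(ξ̄,η̄)(η−η̄)`. -/
def erel (eh : XE → ℝ) (x xb : XE) : ℝ :=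
  eh x - eh xb - dXi eh xb (x.1 - xb.1) - dEta eh xb * (x.2 - xb.2)

/-- The relative total energy `I(v,ξ,η | v̄,ξ̄,η̄) = ½|v−v̄|² + eh(ξ,η|ξ̄,η̄)`. -/
def relI (eh : XE → ℝ) (v vb : Fin 3 → ℝ) (x xb : XE) : ℝ :=
  (1/2) * (∑ i, (v i - vb i)^2) + erel eh x xb

/-- The compact set `Γ_M = {(F̄,v̄,η̄) : |F̄| ≤ M, |v̄| ≤ M, 0 ≤ η̄ ≤ M}`. -/
def Gam (M : ℝ) (Fb : Mat) (vb : Fin 3 → ℝ) (ηb : ℝ) : Prop :=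
  frob Fb ≤ M ∧ Real.sqrt (∑ i, (vb i)^2) ≤ M ∧ 0 ≤ ηb ∧ ηb ≤ M

/-- `|Φ(F) − Φ(F̄)|²` (squared Euclidean distance of the null-Lagrangian vectors). -/
def phidist (F Fb : Mat) : ℝ :=
  frob (F - Fb) ^ 2 + frob (cof F - cof Fb) ^ 2 + (mdet F - mdet Fb) ^ 2

/-! ### Powers and elementary inequalities -/

lemma exists_mul_le_mul_rpow_add {L k s : ℝ} (hL : 0 ≤ L) (hk : 0 < k) (hs : 1 < s) :
    ∃ C : ℝ, ∀ a : ℝ, 0 ≤ a → L * a ≤ k * a ^ s + C := by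
  have hLk : 0 ≤ L / k := by positivity
  refine ⟨L * (L / k) ^ (1 / (s - 1)), fun a ha => ?_⟩
  have hT : 0 ≤ (L / k) ^ (1 / (s - 1)) := by positivity
  rcases le_total a ((L / k) ^ (1 / (s - 1))) with h | h
  · have h1 : 0 ≤ k * a ^ s := by positivity
    have h2 := mul_le_mul_of_nonneg_left h hL
    linarith
  · have h1 : L / k ≤ a ^ (s - 1) := by
      have h2 := Real.rpow_le_rpow hT h (by linarith : 0 ≤ s - 1)
      rwa [← Real.rpow_mul hLk, one_div_mul_cancel (by linarith), Real.rpow_one] at h2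
    have h3 : a ^ s = a ^ (s - 1) * a := by
      rcases ha.eq_or_lt with rfl | hpos
      · rw [Real.zero_rpow (by linarith), mul_zero]
      · rw [← Real.rpow_add_one hpos.ne', sub_add_cancel]
    have h4 : L ≤ k * a ^ (s - 1) := by rwa [div_le_iff₀' hk] at h1
    have h5 := mul_le_mul_of_nonneg_right h4 ha
    have h6 : 0 ≤ L * (L / k) ^ (1 / (s - 1)) := mul_nonneg hL hT
    rw [h3]
    linarith

lemma add_rpow_le_two_rpow_mul {a b s : ℝ} (ha : 0 ≤ a) (hb : 0 ≤ b) (hs : 0 ≤ s) :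
    (a + b) ^ s ≤ 2 ^ s * (a ^ s + b ^ s) := by
  have hA : 0 ≤ a ^ s := Real.rpow_nonneg ha s
  have hB : 0 ≤ b ^ s := Real.rpow_nonneg hb s
  have h2 : (0 : ℝ) ≤ 2 ^ s := by positivity
  rcases le_total a b with h | h
  · calc (a + b) ^ s ≤ (2 * b) ^ s := Real.rpow_le_rpow (by positivity) (by linarith) hs
      _ = 2 ^ s * b ^ s := Real.mul_rpow (by norm_num) hb
      _ ≤ _ := mul_le_mul_of_nonneg_left (by linarith) h2
  · calc (a + b) ^ s ≤ (2 * a) ^ s := Real.rpow_le_rpow (by positivity) (by linarith) hs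
      _ = 2 ^ s * a ^ s := Real.mul_rpow (by norm_num) ha
      _ ≤ _ := mul_le_mul_of_nonneg_left (by linarith) h2

/-! ### The Frobenius norm and continuity of the null Lagrangians -/

lemma frob_nonneg (F : Mat) : 0 ≤ frob F := Real.sqrt_nonneg _

lemma frob_sq (F : Mat) : frob F ^ 2 = ∑ i, ∑ j, F i j ^ 2 :=
  Real.sq_sqrt (by positivity)

lemma norm_le_frob (F : Mat) : ‖F‖ ≤ frob F := by
  refine (pi_norm_le_iff_of_nonneg (frob_nonneg F)).2 fun i =>
    (pi_norm_le_iff_of_nonneg (frob_nonneg F)).2 fun j => ?_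
  refine Real.abs_le_sqrt ?_
  calc F i j ^ 2 ≤ ∑ j, F i j ^ 2 :=
        Finset.single_le_sum (f := fun j => F i j ^ 2) (fun _ _ => sq_nonneg _) (Finset.mem_univ j)
    _ ≤ _ := Finset.single_le_sum (f := fun i => ∑ j, F i j ^ 2)
        (fun _ _ => Finset.sum_nonneg fun _ _ => sq_nonneg _) (Finset.mem_univ i)

lemma frob_sub_le (F G : Mat) : frob (F - G) ≤ 2 * (frob F + frob G) := by
  have hF := frob_nonneg F
  have hG := frob_nonneg G
  have h : frob (F - G) ^ 2 ≤ 2 * frob F ^ 2 + 2 * frob G ^ 2 := by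
    simp only [frob_sq, Finset.mul_sum, ← Finset.sum_add_distrib]
    refine Finset.sum_le_sum fun i _ => Finset.sum_le_sum fun j _ => ?_
    simp only [Pi.sub_apply]
    nlinarith [sq_nonneg (F i j + G i j)]
  refine le_of_sq_le_sq ?_ (by positivity)
  nlinarith [mul_nonneg hF hG]

lemma continuous_cof : Continuous cof := by
  unfold cof
  fun_prop

lemma continuous_mdet : Continuous mdet := by
  unfold mdet
  fun_prop

lemma continuous_Phi : Continuous Phi :=
  continuous_id.prodMk (continuous_cof.prodMk continuous_mdet)

lemma norm_le_sum_frob (x : XE) :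
    ‖x‖ ≤ frob x.1.1 + frob x.1.2.1 + |x.1.2.2| + |x.2| := by
  have h1 := norm_le_frob x.1.1
  have h2 := norm_le_frob x.1.2.1
  have h3 := frob_nonneg x.1.1
  have h4 := frob_nonneg x.1.2.1
  have h5 := abs_nonneg x.1.2.2
  have h6 := abs_nonneg x.2
  simp only [Prod.norm_def, Real.norm_eq_abs, sup_le_iff]
  refine ⟨⟨?_, ?_, ?_⟩, ?_⟩ <;> linarith

/-! ### The domain and the relative energy -/

lemma convex_Dom : Convex ℝ Dom :=
  (convex_Ici (0 : ℝ)).linear_preimage (LinearMap.snd ℝ Xi ℝ)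

lemma uniqueDiffOn_Dom : UniqueDiffOn ℝ Dom := by
  refine uniqueDiffOn_convex convex_Dom ⟨((0, 1) : XE), ?_⟩
  refine mem_interior.2 ⟨{x | 0 < x.2}, fun x (hx : 0 < x.2) => hx.le, ?_, ?_⟩
  · exact isOpen_lt continuous_const continuous_snd
  · exact zero_lt_one (α := ℝ)

lemma erel_eq (eh : XE → ℝ) (x xb : XE) :
    erel eh x xb = eh x - eh xb - fderivWithin ℝ eh Dom xb (x - xb) := by
  have h : x - xb = (x.1 - xb.1, (0 : ℝ)) + (x.2 - xb.2) • ((0, 1) : XE) := by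
    ext <;> simp
  conv_rhs => rw [h, map_add, map_smul, smul_eq_mul]
  unfold erel dXi dEta
  ring

/-- A second-order Taylor lower bound on the unit interval. -/
lemma taylor_lower_bound {g g' g'' : ℝ → ℝ} {m : ℝ}
    (hg : ∀ t ∈ Set.Icc (0 : ℝ) 1, HasDerivWithinAt g (g' t) (Set.Icc 0 1) t)
    (hg' : ∀ t ∈ Set.Icc (0 : ℝ) 1, HasDerivWithinAt g' (g'' t) (Set.Icc 0 1) t)
    (hm : ∀ t ∈ Set.Icc (0 : ℝ) 1, m ≤ g'' t) :
    m / 2 ≤ g 1 - g 0 - g' 0 := by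
  have h1 : MonotoneOn (fun t => g' t - m * t) (Set.Icc 0 1) := by
    have hd : ∀ t ∈ Set.Icc (0 : ℝ) 1,
        HasDerivWithinAt (fun t => g' t - m * t) (g'' t - m * 1) (Set.Icc 0 1) t := fun t ht =>
      (hg' t ht).sub ((hasDerivWithinAt_id t _).const_mul m)
    refine monotoneOn_of_hasDerivWithinAt_nonneg (convex_Icc 0 1)
      (fun t ht => (hd t ht).continuousWithinAt)
      (fun t ht => (hd t (interior_subset ht)).mono interior_subset)
      (fun t ht => ?_)
    have := hm t (interior_subset ht)
    linarith
  have h2 : MonotoneOn (fun t => g t - (g' 0 * t + m / 2 * t ^ 2)) (Set.Icc 0 1) := by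
    have hd : ∀ t ∈ Set.Icc (0 : ℝ) 1,
        HasDerivWithinAt (fun t => g t - (g' 0 * t + m / 2 * t ^ 2))
          (g' t - (g' 0 * 1 + m / 2 * (2 * t))) (Set.Icc 0 1) t := fun t ht => by
      have hsq : HasDerivWithinAt (fun t : ℝ => t ^ 2) (2 * t) (Set.Icc 0 1) t := by
        simpa using (hasDerivAt_pow 2 t).hasDerivWithinAt (s := Set.Icc (0 : ℝ) 1)
      exact (hg t ht).sub
        (((hasDerivWithinAt_id t _).const_mul (g' 0)).add (hsq.const_mul (m / 2)))
    refine monotoneOn_of_hasDerivWithinAt_nonneg (convex_Icc 0 1)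
      (fun t ht => (hd t ht).continuousWithinAt)
      (fun t ht => (hd t (interior_subset ht)).mono interior_subset)
      (fun t ht => ?_)
    have ht' := interior_subset ht
    have := h1 (Set.left_mem_Icc.2 zero_le_one) ht' ht'.1
    simp only [mul_zero, sub_zero] at this
    linarith
  have := h2 (Set.left_mem_Icc.2 zero_le_one) (Set.right_mem_Icc.2 zero_le_one) zero_le_one
  norm_num at this
  linarith

/-- Uniform convexity makes the relative energy dominate the squared distance. -/
lemma erel_lower_bound_of_unifConvex {eh : XE → ℝ} {c : ℝ} (hC2 : ContDiffOn ℝ 2 eh Dom)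
    (hconv : UnifConvex eh c) {x xb : XE} (hx : x ∈ Dom) (hxb : xb ∈ Dom) :
    c / 2 * (frob (x.1.1 - xb.1.1) ^ 2 + frob (x.1.2.1 - xb.1.2.1) ^ 2
      + (x.1.2.2 - xb.1.2.2) ^ 2 + (x.2 - xb.2) ^ 2) ≤ erel eh x xb := by
  set d : XE := x - xb with hd
  have hline : ∀ t : ℝ, HasDerivWithinAt (fun t : ℝ => xb + t • d) d (Set.Icc 0 1) t := fun t => by
    simpa using (((hasDerivAt_id t).smul_const d).const_add xb).hasDerivWithinAt
  have hmaps : Set.MapsTo (fun t : ℝ => xb + t • d) (Set.Icc 0 1) Dom := fun t ht =>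
    convex_Dom.add_smul_sub_mem hxb hx ht
  have hdiff : DifferentiableOn ℝ eh Dom := hC2.differentiableOn (by norm_num)
  have hdiff' : DifferentiableOn ℝ (fun y => fderivWithin ℝ eh Dom y d) Dom :=
    ((hC2.fderivWithin uniqueDiffOn_Dom (m := 1) (by norm_num)).differentiableOn
      (by norm_num)).clm_apply (differentiableOn_const d)
  have key := taylor_lower_bound (g := fun t => eh (xb + t • d))
    (g' := fun t => fderivWithin ℝ eh Dom (xb + t • d) d)
    (g'' := fun t => d2 eh (xb + t • d) d d)
    (fun t ht => ((hdiff _ (hmaps ht)).hasFDerivWithinAt).comp_hasDerivWithinAt t (hline t) hmaps)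
    (fun t ht => HasFDerivWithinAt.comp_hasDerivWithinAt
      (l := fun y => fderivWithin ℝ eh Dom y d) t (hdiff' _ (hmaps ht)).hasFDerivWithinAt
      (hline t) hmaps)
    (fun t ht => hconv _ (hmaps ht) d)
  have h1 : xb + d = x := by rw [hd]; abel
  simp only [one_smul, zero_smul, add_zero, h1] at key
  rw [erel_eq, ← hd]
  refine le_trans (le_of_eq ?_) key
  simp only [hd, Prod.fst_sub, Prod.snd_sub]
  ring

/-- Relative to base points in a bounded set of null-Lagrangian states, the relative energy
grows like the weight of the growth conditions. -/
lemma exists_erel_lower_bound_of_growth {eh : XE → ℝ} {cg p q ρ ℓ : ℝ} (hcg : 0 < cg)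
    (hp : 1 < p) (hq : 1 < q) (hρ : 1 < ρ) (hℓ : 1 < ℓ) (hC1 : ContDiffOn ℝ 1 eh Dom)
    (hG1 : GrowthG1 eh cg p q ρ ℓ) (M : ℝ) :
    ∃ C : ℝ, ∀ x ∈ Dom, ∀ (Fb : Mat) (ηb : ℝ), frob Fb ≤ M → 0 ≤ ηb → ηb ≤ M →
      cg / 2 * bigN p q ρ ℓ x - C ≤ erel eh x (Phi Fb, ηb) := by
  let K : Set XE := (fun y : Mat × ℝ => ((Phi y.1, y.2) : XE)) ''
    (Metric.closedBall 0 M ×ˢ Set.Icc 0 M)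
  have hK : IsCompact K := ((isCompact_closedBall _ _).prod isCompact_Icc).image
    ((continuous_Phi.comp continuous_fst).prodMk continuous_snd)
  have hKD : K ⊆ Dom := by
    rintro _ ⟨y, hy, rfl⟩
    exact hy.2.1
  obtain ⟨B, hB⟩ := hK.exists_bound_of_continuousOn continuousOn_id
  obtain ⟨E, hE⟩ := hK.exists_bound_of_continuousOn (hC1.continuousOn.mono hKD)
  obtain ⟨L, hL⟩ := hK.exists_bound_of_continuousOn
    ((hC1.continuousOn_fderivWithin uniqueDiffOn_Dom (by norm_num)).mono hKD)
  have hL0 : 0 ≤ |L| := abs_nonneg L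
  obtain ⟨C₁, h₁⟩ := exists_mul_le_mul_rpow_add hL0 (half_pos hcg) hp
  obtain ⟨C₂, h₂⟩ := exists_mul_le_mul_rpow_add hL0 (half_pos hcg) hq
  obtain ⟨C₃, h₃⟩ := exists_mul_le_mul_rpow_add hL0 (half_pos hcg) hρ
  obtain ⟨C₄, h₄⟩ := exists_mul_le_mul_rpow_add hL0 (half_pos hcg) hℓ
  refine ⟨cg + E + |L| * B + (C₁ + C₂ + C₃ + C₄), fun x hx Fb ηb hFb h0 hM => ?_⟩
  have hmem : ((Phi Fb, ηb) : XE) ∈ K :=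
    ⟨(Fb, ηb), ⟨mem_closedBall_zero_iff.2 ((norm_le_frob Fb).trans hFb), h0, hM⟩, rfl⟩
  generalize ((Phi Fb, ηb) : XE) = xb at hmem
  have hxB : ‖xb‖ ≤ B := hB xb hmem
  have hxE : eh xb ≤ E := (le_abs_self _).trans (hE xb hmem)
  have hlin : fderivWithin ℝ eh Dom xb (x - xb) ≤ |L| * (‖x‖ + B) :=
    calc fderivWithin ℝ eh Dom xb (x - xb)
        ≤ ‖fderivWithin ℝ eh Dom xb (x - xb)‖ := Real.le_norm_self _
      _ ≤ ‖fderivWithin ℝ eh Dom xb‖ * ‖x - xb‖ := ContinuousLinearMap.le_opNorm _ _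
      _ ≤ |L| * (‖x‖ + B) := by
        refine mul_le_mul ((hL xb hmem).trans (le_abs_self L)) ?_ (norm_nonneg _) hL0
        exact (norm_sub_le _ _).trans (by linarith)
  have hx' := mul_le_mul_of_nonneg_left (norm_le_sum_frob x) hL0
  have e₁ := h₁ _ (frob_nonneg x.1.1)
  have e₂ := h₂ _ (frob_nonneg x.1.2.1)
  have e₃ := h₃ _ (abs_nonneg x.1.2.2)
  have e₄ := h₄ _ (abs_nonneg x.2)
  have hlow := (hG1 x hx).1
  rw [erel_eq]
  unfold bigN at hlow ⊢
  linarith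

lemma exists_distance_upper_bound {p ℓ : ℝ} (hp : 0 ≤ p) (hℓ : 0 ≤ ℓ) (M : ℝ) :
    ∃ A > (0 : ℝ), ∃ B : ℝ, ∀ (F Fb : Mat) (v vb : Fin 3 → ℝ) (η ηb : ℝ),
      0 ≤ η → Gam M Fb vb ηb →
      frob (F - Fb) ^ p + |η - ηb| ^ ℓ + ∑ i, (v i - vb i) ^ 2
        ≤ A * (frob F ^ p + η ^ ℓ + ∑ i, v i ^ 2) + B := by
  refine ⟨2 ^ p * 2 ^ p + 2 ^ ℓ + 2, by positivity,
    2 ^ p * 2 ^ p * M ^ p + 2 ^ ℓ * M ^ ℓ + 2 * M ^ 2, fun F Fb v vb η ηb hη hΓ => ?_⟩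
  obtain ⟨hFb, hvb, h0, hηb⟩ := hΓ
  have hM : 0 ≤ M := h0.trans hηb
  have hF := frob_nonneg F
  have e₁ : frob (F - Fb) ^ p ≤ 2 ^ p * (2 ^ p * (frob F ^ p + M ^ p)) :=
    calc frob (F - Fb) ^ p ≤ (2 * (frob F + M)) ^ p :=
          Real.rpow_le_rpow (frob_nonneg _) ((frob_sub_le F Fb).trans (by linarith)) hp
      _ = 2 ^ p * (frob F + M) ^ p := Real.mul_rpow (by norm_num) (by positivity)
      _ ≤ _ := mul_le_mul_of_nonneg_left (add_rpow_le_two_rpow_mul hF hM hp) (by positivity)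
  have e₂ : |η - ηb| ^ ℓ ≤ 2 ^ ℓ * (η ^ ℓ + M ^ ℓ) :=
    (Real.rpow_le_rpow (abs_nonneg _) (abs_le.2 ⟨by linarith, by linarith⟩) hℓ).trans
      (add_rpow_le_two_rpow_mul hη hM hℓ)
  have hvb' : ∑ i, vb i ^ 2 ≤ M ^ 2 := (Real.sqrt_le_left hM).1 hvb
  have e₃ : ∑ i, (v i - vb i) ^ 2 ≤ 2 * ∑ i, v i ^ 2 + 2 * ∑ i, vb i ^ 2 := by
    simp only [Finset.mul_sum, ← Finset.sum_add_distrib]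
    refine Finset.sum_le_sum fun i _ => ?_
    nlinarith [sq_nonneg (v i + vb i)]
  have f₁ : 0 ≤ frob F ^ p := Real.rpow_nonneg hF p
  have f₂ : 0 ≤ η ^ ℓ := Real.rpow_nonneg hη ℓ
  have f₃ : 0 ≤ ∑ i, v i ^ 2 := Finset.sum_nonneg fun _ _ => sq_nonneg _
  have g₁ : (0 : ℝ) ≤ 2 ^ p * 2 ^ p := by positivity
  have g₂ : (0 : ℝ) ≤ 2 ^ ℓ := by positivity
  linarith [mul_nonneg g₁ f₂, mul_nonneg g₁ f₃, mul_nonneg g₂ f₁, mul_nonneg g₂ f₃]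

lemma sum_sub_sq_lower_bound {M : ℝ} (hM : 0 ≤ M) (v vb : Fin 3 → ℝ)
    (hvb : Real.sqrt (∑ i, vb i ^ 2) ≤ M) :
    (1 / 4) * ∑ i, v i ^ 2 - M ^ 2 / 2 ≤ (1 / 2) * ∑ i, (v i - vb i) ^ 2 := by
  have hvb' : ∑ i, vb i ^ 2 ≤ M ^ 2 := (Real.sqrt_le_left hM).1 hvb
  have h : ∑ i, v i ^ 2 ≤ 2 * ∑ i, (v i - vb i) ^ 2 + 2 * ∑ i, vb i ^ 2 := by
    simp only [Finset.mul_sum, ← Finset.sum_add_distrib]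
    refine Finset.sum_le_sum fun i _ => ?_
    nlinarith [sq_nonneg (v i - 2 * vb i)]
  linarith

/-- relative entropy lower bound, part (IV).  Under uniform
convexity and (G1)–(G3), for every `M > 0` there are `K₁′, K₂′ > 0` and `R > 0`
(sufficiently large) such that for all `(F,v,η)` and `(F̄,v̄,η̄) ∈ Γ_M`:
if `|F|^p + η^ℓ + |v|² > R` then
`I(v,Φ(F),η|v̄,Φ(F̄),η̄) ≥ (K₁′/4)(|F−F̄|^p + |η−η̄|^ℓ + |v−v̄|²)`,
and otherwise `I ≥ K₂′(|Φ(F)−Φ(F̄)|² + |η−η̄|² + |v−v̄|²)`. -/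
theorem relative_entropy_lower_bound_IV
    (c cg p q ρ ℓ : ℝ) (eh : XE → ℝ)
    (hc : 0 < c) (hcg : 0 < cg)
    (hp : 4 ≤ p) (hq : 2 ≤ q) (hρ : 1 < ρ) (hℓ : 1 < ℓ)
    (hC3 : ContDiffOn ℝ 3 eh Dom)
    (hconv : UnifConvex eh c)
    (hG1 : GrowthG1 eh cg p q ρ ℓ)
    (hG2 : GrowthG2 eh p q ρ ℓ)
    (hG3 : GrowthG3 eh cg p q ρ ℓ)
    :
    ∀ M > (0:ℝ), ∃ K₁' > (0:ℝ), ∃ K₂' > (0:ℝ), ∃ R > (0:ℝ),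
      ∀ (F Fb : Mat) (v vb : Fin 3 → ℝ) (η ηb : ℝ),
        0 ≤ η → Gam M Fb vb ηb →
        (frob F ^ p + η ^ ℓ + (∑ i, (v i)^2) > R →
          K₁' / 4 * (frob (F - Fb) ^ p + |η - ηb| ^ ℓ + (∑ i, (v i - vb i)^2))
            ≤ relI eh v vb (Phi F, η) (Phi Fb, ηb))
        ∧ (frob F ^ p + η ^ ℓ + (∑ i, (v i)^2) ≤ R →
          K₂' * (phidist F Fb + (η - ηb)^2 + (∑ i, (v i - vb i)^2))
            ≤ relI eh v vb (Phi F, η) (Phi Fb, ηb)) := by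
  intro M hM
  obtain ⟨C, hC⟩ := exists_erel_lower_bound_of_growth hcg (by linarith) (by linarith) hρ hℓ
    (hC3.of_le (by norm_num)) hG1 M
  obtain ⟨A, hA, B, hB⟩ := exists_distance_upper_bound (p := p) (ℓ := ℓ) (by linarith)
    (by linarith) M
  obtain ⟨k, hk, hkc, hk4⟩ : ∃ k > (0 : ℝ), k ≤ cg / 2 ∧ k ≤ 1 / 4 :=
    ⟨min (cg / 2) (1 / 4), lt_min (by positivity) (by norm_num), min_le_left _ _, min_le_right _ _⟩
  obtain ⟨m, hm, hmc, hm2⟩ : ∃ m > (0 : ℝ), m ≤ c / 2 ∧ m ≤ 1 / 2 :=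
    ⟨min (c / 2) (1 / 2), lt_min (by positivity) (by norm_num), min_le_left _ _, min_le_right _ _⟩
  have hKA : k / (2 * A) * A = k / 2 := by field_simp
  set K : ℝ := k / (2 * A) with hK
  have hKpos : 0 < K := by positivity
  set D : ℝ := |C + M ^ 2 / 2 + K * B| with hD
  have hDle : C + M ^ 2 / 2 + K * B ≤ D := le_abs_self _
  have hD0 : 0 ≤ D := abs_nonneg _
  refine ⟨4 * K, by positivity, m, hm, 2 * D / k + 1, by positivity, ?_⟩
  intro F Fb v vb η ηb hη hΓ
  have hdist := hB F Fb v vb η ηb hη hΓ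
  obtain ⟨hFb, hvb, h0, hηb⟩ := hΓ
  have hx : ((Phi F, η) : XE) ∈ Dom := hη
  refine ⟨fun hS => ?_, fun _ => ?_⟩
  · have hgrow := hC _ hx Fb ηb hFb h0 hηb
    have hkin := sum_sub_sq_lower_bound hM.le v vb hvb
    have f₁ : 0 ≤ frob F ^ p := Real.rpow_nonneg (frob_nonneg F) p
    have f₂ : 0 ≤ η ^ ℓ := Real.rpow_nonneg hη ℓ
    have f₃ : 0 ≤ ∑ i, v i ^ 2 := Finset.sum_nonneg fun _ _ => sq_nonneg _
    have hN : frob F ^ p + η ^ ℓ ≤ bigN p q ρ ℓ (Phi F, η) := by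
      have g₁ : 0 ≤ frob (cof F) ^ q := Real.rpow_nonneg (frob_nonneg _) q
      have g₂ : 0 ≤ |mdet F| ^ ρ := Real.rpow_nonneg (abs_nonneg _) ρ
      simp only [bigN, Phi, abs_of_nonneg hη]
      linarith
    have hN' := mul_le_mul_of_nonneg_left hN (half_pos hcg).le
    have hkN := mul_le_mul_of_nonneg_right hkc (add_nonneg f₁ f₂)
    have hkv := mul_le_mul_of_nonneg_right hk4 f₃
    have hR : 2 * D < k * (frob F ^ p + η ^ ℓ + ∑ i, v i ^ 2) := by
      rw [← div_lt_iff₀' hk]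
      linarith
    have hKd := mul_le_mul_of_nonneg_left hdist hKpos.le
    rw [mul_add K (A * _) B, ← mul_assoc, hKA] at hKd
    rw [mul_div_cancel_left₀ K (by norm_num : (4 : ℝ) ≠ 0)]
    unfold relI
    linarith
  · have hconvex := erel_lower_bound_of_unifConvex (hC3.of_le (by norm_num)) hconv hx
      (show ((Phi Fb, ηb) : XE) ∈ Dom from h0)
    simp only [Phi] at hconvex
    have hv : 0 ≤ ∑ i, (v i - vb i) ^ 2 := Finset.sum_nonneg fun _ _ => sq_nonneg _
    have hd : 0 ≤ phidist F Fb + (η - ηb) ^ 2 := by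
      unfold phidist
      positivity
    have h₁ := mul_le_mul_of_nonneg_right hmc hd
    have h₂ := mul_le_mul_of_nonneg_right hm2 hv
    unfold relI
    unfold phidist at h₁ ⊢
    simp only [Phi]
    linarith
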